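/- arXiv:2604.25051 — 2 statements merged into one kernel-verified Lean document; each statement's English description precedes it below -/
import Mathlib

section
/- Let $\ell\ge 1$ and let $0<m<\gamma_1<\dots<\gamma_{\ell-1}<c$ be integers. Put $\Gamma=\{\gamma_1,\dots,\gamma_{\ell-1}\}$ and let $S=\langle m,\Gamma\rangle_c$ be the numerical semigroup generated by $m$, the elements of $\Gamma$ and all integers $\ge c$. For $i\ge 0$ let $i\Gamma$ denote the $i$-fold sumset of $\Gamma$, i.e. the set of all sums of $i$ elements of $\Gamma$ with repetition allowed, so that $0\Gamma=\{0\}$. Let $h\ge 1$ be an integer and suppose that $S$ is $h$-regular, i.e. $h\Gamma\subset[c,c+m)$. An $h$-Farey fraction is a reduced fraction $a/b$ with $1\le b\le h$; let $a'/b'<a/b$ be the consecutive $h$-Farey fractions such that $\frac{c+m}{hm}\in(a'/b',\,a/b]$. Then for every $0\le i\le h-1$ and every $\lambda\in i\Gamma$, $$\left\lfloor\frac{(h-i)a'}{b'}\right\rfloor\le\left\lceil\frac{c-\lambda}{m}\right\rceil\le\left\lfloor\frac{(h-i)a'}{b'}\right\rfloor+1.$$ Moreover, $\left\lceil\frac{c-\lambda}{m}\right\rceil$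 is the number of elements of $S$ of the form $\lambda+jm$ with $j\in\mathbb{N}=\{0,1,2,\dots\}$ that are smaller than $c$. -/
/-- `a/b` is an `h`-Farey fraction: a reduced fraction with `1 ≤ b ≤ h`. -/
def IsFareyFrac (h : ℕ) (a b : ℤ) : Prop :=
  0 < b ∧ b ≤ (h : ℤ) ∧ IsCoprime a b

/-- `(a'/b', a/b]` is an `h`-Farey interval: `a'/b' < a/b` are `h`-Farey fractions
and no `h`-Farey fraction lies strictly between them. -/
def IsFareyInterval (h : ℕ) (a' b' a b : ℤ) : Prop :=
  IsFareyFrac h a' b' ∧ IsFareyFrac h a b ∧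
    (a' : ℚ) / (b' : ℚ) < (a : ℚ) / (b : ℚ) ∧
    ∀ p q : ℤ, IsFareyFrac h p q →
      (p : ℚ) / (q : ℚ) ≤ (a' : ℚ) / (b' : ℚ) ∨ (a : ℚ) / (b : ℚ) ≤ (p : ℚ) / (q : ℚ)

/-- The numerical semigroup `⟨m, Γ⟩_c`: the additive submonoid of `ℕ` generated by `m`,
the elements of `Γ` and all integers `≥ c`. -/
def numSemigroup (m : ℕ) (Γ : Finset ℕ) (c : ℕ) : AddSubmonoid ℕ :=
  AddSubmonoid.closure ({m} ∪ (Γ : Set ℕ) ∪ Set.Ici c)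

/-- The `i`-fold sumset `iΓ`: sums of `i` elements of `Γ`, repetitions allowed;
in particular `0Γ = {0}`. -/
def sumset (Γ : Finset ℕ) : ℕ → Set ℕ
  | 0 => {0}
  | i + 1 => {x : ℕ | ∃ g ∈ Γ, ∃ y ∈ sumset Γ i, x = g + y}

/-- `⟨m, Γ⟩_c` is `h`-regular: `hΓ ⊆ [c, c + m)`. -/
def IsHRegular (h m : ℕ) (Γ : Finset ℕ) (c : ℕ) : Prop :=
  sumset Γ h ⊆ Set.Ico c (c + m)

/-- A rational `p / q` with `0 < q ≤ h` exceeding the left end of an `h`-Farey interval is at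
least its right end, whether or not `p / q` is reduced. -/
lemma IsFareyInterval.le_div_of_lt {h : ℕ} {a' b' a b : ℤ} (hF : IsFareyInterval h a' b' a b)
    {p q : ℤ} (hq : 0 < q) (hqh : q ≤ h) (hlt : (a' : ℚ) / b' < (p : ℚ) / q) :
    (a : ℚ) / b ≤ (p : ℚ) / q := by
  have hden : (((p : ℚ) / q).den : ℤ) ≤ q := by
    refine Int.le_of_dvd hq ?_
    have := Rat.den_dvd p q
    rwa [Rat.divInt_eq_div] at this
  have hfrac : IsFareyFrac h ((p : ℚ) / q).num ((p : ℚ) / q).den := by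
    refine ⟨by exact_mod_cast ((p : ℚ) / q).den_pos, hden.trans hqh, ?_⟩
    exact Int.isCoprime_iff_nat_coprime.2 (by simpa using ((p : ℚ) / q).reduced)
  have key := hF.2.2.2 _ _ hfrac
  rw [Int.cast_natCast, Rat.num_div_den] at key
  exact key.resolve_left (not_le.2 hlt)

lemma mul_mem_sumset {Γ : Finset ℕ} {γ : ℕ} (hγ : γ ∈ Γ) (n : ℕ) : n * γ ∈ sumset Γ n := by
  induction n with
  | zero => simp [sumset]
  | succ n ih => exact ⟨γ, hγ, _, ih, by ring⟩

/-- In an `h`-regular semigroup the elements `x` of `iΓ` satisfy `ic ≤ hx ≤ i(c + m)`. -/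
lemma IsHRegular.mul_bounds {h m c : ℕ} {Γ : Finset ℕ} (hreg : IsHRegular h m Γ c)
    {i x : ℕ} (hx : x ∈ sumset Γ i) : i * c ≤ h * x ∧ h * x ≤ i * (c + m) := by
  induction i generalizing x with
  | zero =>
    obtain rfl : x = 0 := hx
    simp
  | succ i ih =>
    obtain ⟨γ, hγ, y, hy, rfl⟩ := hx
    have hmem := hreg (mul_mem_sumset hγ h)
    obtain ⟨h1, h2⟩ := ih hy
    constructor
    · linarith [hmem.1]
    · linarith [hmem.2]

lemma sumset_subset_numSemigroup (m : ℕ) (Γ : Finset ℕ) (c i : ℕ) :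
    sumset Γ i ⊆ numSemigroup m Γ c := by
  induction i with
  | zero =>
    rintro x (rfl : x = 0)
    exact zero_mem _
  | succ i ih =>
    rintro x ⟨γ, hγ, y, hy, rfl⟩
    exact add_mem (AddSubmonoid.subset_closure (Or.inl (Or.inr hγ))) (ih hy)

/-- For `x` in the semigroup, the number of elements `x + jm` below `c` is `⌈(c - x)/m⌉`,
as soon as the latter is nonnegative. -/
lemma ceil_eq_ncard_progression {m c x : ℕ} {Γ : Finset ℕ} (hm : 0 < m)
    (hx : x ∈ numSemigroup m Γ c) (hnonneg : 0 ≤ ⌈((c : ℚ) - x) / m⌉) :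
    ⌈((c : ℚ) - x) / m⌉ =
      ({y : ℕ | y ∈ numSemigroup m Γ c ∧ (∃ j : ℕ, y = x + j * m) ∧ y < c}.ncard : ℤ) := by
  have hm' : (0 : ℚ) < m := by exact_mod_cast hm
  obtain ⟨n, hn⟩ := Int.eq_ofNat_of_zero_le hnonneg
  have hiff : ∀ j : ℕ, j < n ↔ x + j * m < c := by
    intro j
    have h1 : j < n ↔ (j : ℤ) < ⌈((c : ℚ) - x) / m⌉ := by rw [hn]; exact Int.ofNat_lt.symm
    rw [h1, Int.lt_ceil, lt_div_iff₀ hm', lt_sub_iff_add_lt']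
    exact_mod_cast Iff.rfl
  have hmm : m ∈ numSemigroup m Γ c := AddSubmonoid.subset_closure (Or.inl (Or.inl rfl))
  have hset : {y : ℕ | y ∈ numSemigroup m Γ c ∧ (∃ j : ℕ, y = x + j * m) ∧ y < c} =
      ((Finset.range n).image fun j => x + j * m : Finset ℕ) := by
    ext y
    simp only [Set.mem_ofPred_eq, Finset.coe_image, Finset.coe_range, Set.mem_image, Set.mem_Iio]
    constructor
    · rintro ⟨-, ⟨j, rfl⟩, hlt⟩
      exact ⟨j, (hiff j).2 hlt, rfl⟩
    · rintro ⟨j, hj, rfl⟩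
      exact ⟨add_mem hx (by simpa using nsmul_mem hmm j), ⟨j, rfl⟩, (hiff j).1 hj⟩
  have hinj : Function.Injective fun j : ℕ => x + j * m := fun j k hjk =>
    Nat.eq_of_mul_eq_mul_right hm (Nat.add_left_cancel hjk)
  rw [hset, Set.ncard_coe_finset, Finset.card_image_of_injective _ hinj, Finset.card_range, hn]

/-- Let `0 < m < c` and let `Γ` be a finite set of integers in `(m, c)`. If `⟨m, Γ⟩_c` is
`h`-regular and `(a'/b', a/b]` is the `h`-Farey interval containing `(c + m)/(hm)`, then for
`0 ≤ i ≤ h - 1` and `λ ∈ iΓ` one has `⌊(h-i)a'/b'⌋ ≤ ⌈(c-λ)/m⌉ ≤ ⌊(h-i)a'/b'⌋ + 1`, and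
`⌈(c-λ)/m⌉` is the number of elements of the semigroup of the form `λ + jm`, `j ∈ ℕ`,
that are smaller than `c`. -/
theorem hregular_short_bounds (h : ℕ) (hh : 1 ≤ h) (m c : ℕ) (Γ : Finset ℕ)
    (hm : 0 < m) (hmc : m < c) (hΓ : ∀ γ ∈ Γ, m < γ ∧ γ < c)
    (hreg : IsHRegular h m Γ c)
    (a' b' a b : ℤ) (hF : IsFareyInterval h a' b' a b)
    (hmem : ((c : ℚ) + (m : ℚ)) / ((h : ℚ) * (m : ℚ)) ∈
      Set.Ioc ((a' : ℚ) / (b' : ℚ)) ((a : ℚ) / (b : ℚ))) :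
    ∀ i : ℕ, i < h → ∀ lam ∈ sumset Γ i,
      ⌊((h : ℚ) - (i : ℚ)) * (a' : ℚ) / (b' : ℚ)⌋ ≤ ⌈((c : ℚ) - (lam : ℚ)) / (m : ℚ)⌉ ∧
      ⌈((c : ℚ) - (lam : ℚ)) / (m : ℚ)⌉ ≤ ⌊((h : ℚ) - (i : ℚ)) * (a' : ℚ) / (b' : ℚ)⌋ + 1 ∧
      ⌈((c : ℚ) - (lam : ℚ)) / (m : ℚ)⌉ =
        ({x : ℕ | x ∈ numSemigroup m Γ c ∧ (∃ j : ℕ, x = lam + j * m) ∧ x < c}.ncard : ℤ) := by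
  intro i hi lam hlam
  have hm' : (0 : ℚ) < m := by exact_mod_cast hm
  have hh' : (0 : ℚ) < h := by exact_mod_cast hh
  have hk : (0 : ℚ) < (h : ℚ) - i := sub_pos.2 (by exact_mod_cast hi)
  obtain ⟨hlow, hupp⟩ := hreg.mul_bounds hlam
  have hlowQ : (i : ℚ) * c ≤ h * lam := by exact_mod_cast hlow
  have huppQ : (h : ℚ) * lam ≤ i * (c + m) := by exact_mod_cast hupp
  set x : ℚ := ((c : ℚ) + m) / (h * m) with hx
  have hxpos : 0 < x := by positivity
  have hxm : h * (x * m) = (c : ℚ) + m := by rw [hx]; field_simp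
  have hz_low : ((h : ℚ) - i) * x - 1 ≤ ((c : ℚ) - lam) / m := by
    rw [le_div_iff₀ hm']
    refine le_of_mul_le_mul_left ?_ hh'
    linear_combination huppQ + ((h : ℚ) - i) * hxm
  have hz_upp : ((c : ℚ) - lam) / m ≤ ((h : ℚ) - i) * x := by
    rw [div_le_iff₀ hm']
    refine le_of_mul_le_mul_left ?_ hh'
    have : 0 ≤ ((h : ℚ) - i) * m := by positivity
    linear_combination hlowQ + this - ((h : ℚ) - i) * hxm
  have hnonneg : 0 ≤ ⌈((c : ℚ) - lam) / m⌉ := by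
    rw [← Int.sub_one_lt_iff, Int.lt_ceil]
    have := mul_pos hk hxpos
    push_cast
    linarith
  refine ⟨?_, ?_, ceil_eq_ncard_progression hm (sumset_subset_numSemigroup m Γ c i hlam) hnonneg⟩
  · rw [← Int.sub_one_lt_iff, Int.lt_ceil]
    have h1 := mul_lt_mul_of_pos_left hmem.1 hk
    have h2 := Int.floor_le (((h : ℚ) - i) * a' / b')
    rw [← mul_div_assoc] at h1
    push_cast
    linarith
  · rw [Int.ceil_le]
    refine hz_upp.trans ?_
    have h1 := Int.lt_floor_add_one (((h : ℚ) - i) * a' / b')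
    set N := ⌊((h : ℚ) - i) * a' / b'⌋
    have hlt : (a' : ℚ) / b' < ((N + 1 : ℤ) : ℚ) / ((h - i : ℤ) : ℚ) := by
      push_cast
      rwa [lt_div_iff₀ hk, mul_comm, ← mul_div_assoc]
    have h2 := hmem.2.trans (hF.le_div_of_lt (by omega) (by omega) hlt)
    push_cast at h2 ⊢
    rwa [le_div_iff₀ hk, mul_comm] at h2
end

section
/- For an integer $h\ge 1$, an $h$-Farey fraction is a reduced fraction $a/b$ with $1\le b\le h$; if $a'/b'<a/b$ are consecutive $h$-Farey fractions, then $a'/b'$ is the predecessor of $a/b$ and $(a'/b',a/b]$ is an $h$-Farey interval. Let $h\ge 2$ be an integer, $a/b$ an $h$-Farey fraction with $h$-Farey predecessor $a'/b'$, $\Delta\subset\mathbb N$ a finite nonempty set with $\delta_1=\max\Delta$, and $\tau,m$ integers. Let $S=S(h,a/b,\Delta,\tau,m)=\langle m,\Gamma\rangle_c$ be the semigroup generated by $m$, the elements of $\Gamma$ and all integers $\ge c$, where $$c=\left\lfloor\frac{ahm}{b}\right\rfloor-m-\tau,\qquad \Gamma=\left\{\left\lfloor\frac{c+m-1}{h}\right\rfloor-\delta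 : \delta\in\Delta\right\}.$$ Put $t=ahm/b-c-m$ and $w=c+m-h\gamma_1$, where $\gamma_1=\min\Gamma$. Call $S$ $h$-regular if $h\Gamma\subset[c,c+m)$, where $h\Gamma$ is the $h$-fold sumset of $\Gamma$. Then $$t=\tau+\operatorname{frac}\left(\frac{ahm}{b}\right)\qquad\text{and}\qquad w=h\delta_1+1+\bigl((c+m-1)\bmod h\bigr).$$ Moreover, $S$ is $h$-regular if and only if $m\ge w$; and, if $m>0$ and $\tau\ge 0$, the $h$-Farey interval containing $\frac{c+m}{hm}$ is $(a'/b',a/b]$ if and only if $m>bb't/h$. -/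
namespace Eliahou

/-- `a/b` is an `h`-Farey fraction: a reduced fraction with `1 ≤ b ≤ h`. -/
def IsFareyFrac (h : ℕ) (a b : ℤ) : Prop :=
  0 < b ∧ b ≤ (h : ℤ) ∧ IsCoprime a b

/-- `a'/b'` is the `h`-Farey predecessor of `a/b`: both are `h`-Farey fractions, `a'/b' < a/b`,
and no `h`-Farey fraction lies strictly between them. -/
def IsFareyPred (h : ℕ) (a b a' b' : ℤ) : Prop :=
  IsFareyFrac h a b ∧ IsFareyFrac h a' b' ∧
    (a' : ℚ) / (b' : ℚ) < (a : ℚ) / (b : ℚ) ∧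
    ∀ p q : ℤ, IsFareyFrac h p q →
      (p : ℚ) / (q : ℚ) ≤ (a' : ℚ) / (b' : ℚ) ∨ (a : ℚ) / (b : ℚ) ≤ (p : ℚ) / (q : ℚ)

/-- `(a'/b', a/b]` is the `h`-Farey interval containing `x`. -/
def IsFareyIntervalOf (h : ℕ) (x : ℚ) (a b a' b' : ℤ) : Prop :=
  IsFareyPred h a b a' b' ∧ x ∈ Set.Ioc ((a' : ℚ) / (b' : ℚ)) ((a : ℚ) / (b : ℚ))

/-- The data `(m, Γ, c)` presenting a semigroup `⟨m, Γ⟩_c`. -/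
structure Presentation where
  m : ℤ
  Γ : Finset ℤ
  c : ℤ

/-- The semigroup `⟨m, Γ⟩_c` generated by `m`, the elements of `Γ` and all integers `≥ c`. -/
def Presentation.toAddSubmonoid (S : Presentation) : AddSubmonoid ℤ :=
  AddSubmonoid.closure ({S.m} ∪ (S.Γ : Set ℤ) ∪ Set.Ici S.c)

/-- The `h`-fold sumset `hΓ`. -/
def sumset (h : ℕ) (Γ : Finset ℤ) : Set ℤ :=
  {x : ℤ | ∃ g : Fin h → ℤ, (∀ i, g i ∈ Γ) ∧ x = ∑ i, g i}

/-- `⟨m, Γ⟩_c` is `h`-regular: `hΓ ⊆ [c, c+m)`. -/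
def Presentation.IsRegular (h : ℕ) (S : Presentation) : Prop :=
  sumset h S.Γ ⊆ Set.Ico S.c (S.c + S.m)

/-- The conductor `c = ⌊ahm/b⌋ − m − τ`. -/
def conductor (h : ℕ) (a b τ m : ℤ) : ℤ :=
  ⌊(a : ℚ) * (h : ℚ) * (m : ℚ) / (b : ℚ)⌋ - m - τ

/-- The set `Γ = ⌊(c + m − 1)/h⌋ − Δ` (elementwise). -/
def leftGens (h : ℕ) (a b : ℤ) (Δ : Finset ℕ) (τ m : ℤ) : Finset ℤ :=
  Δ.image fun δ : ℕ => ⌊((conductor h a b τ m + m - 1 : ℤ) : ℚ) / (h : ℚ)⌋ - (δ : ℤ)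

/-- The construction `S(h, a/b, Δ, τ, m) = ⟨m, Γ⟩_c`. -/
def construction (h : ℕ) (a b : ℤ) (Δ : Finset ℕ) (τ m : ℤ) : Presentation where
  m := m
  Γ := leftGens h a b Δ τ m
  c := conductor h a b τ m

theorem construction_Γ_nonempty (h : ℕ) (a b : ℤ) (Δ : Finset ℕ) (hΔ : Δ.Nonempty) (τ m : ℤ) :
    (construction h a b Δ τ m).Γ.Nonempty :=
  hΔ.image _

/-- `t = ahm/b − c − m`. -/
def tParam (h : ℕ) (a b : ℤ) (S : Presentation) : ℚ :=
  (a : ℚ) * (h : ℚ) * (S.m : ℚ) / (b : ℚ) - (S.c : ℚ) - (S.m : ℚ)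

/-- `w = c + m − hγ₁`, where `γ₁ = min Γ`. -/
def wParam (h : ℕ) (S : Presentation) (hΓ : S.Γ.Nonempty) : ℤ :=
  S.c + S.m - (h : ℤ) * S.Γ.min' hΓ

end Eliahou

namespace Eliahou

/-- For every `h`-Farey fraction `a/b` there is an `h`-Farey fraction `p/q` with `aq - pb = 1`
whose denominator lies in `(h - b, h]`. -/
theorem exists_left_neighbour {h : ℕ} {a b : ℤ} (hF : IsFareyFrac h a b) :
    ∃ p q : ℤ, IsFareyFrac h p q ∧ a * q - p * b = 1 ∧ (h : ℤ) < b + q := by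
  obtain ⟨hb, hbh, u, v, huv⟩ := hF
  have hr0 := Int.emod_nonneg ((h : ℤ) - u) hb.ne'
  have hr1 := Int.emod_lt_of_pos ((h : ℤ) - u) hb
  have hdiv := Int.mul_ediv_add_emod ((h : ℤ) - u) b
  set k := ((h : ℤ) - u) / b
  set r := ((h : ℤ) - u) % b
  have hdet : a * (u + b * k) - (a * k - v) * b = 1 := by linear_combination huv
  exact ⟨a * k - v, u + b * k, ⟨by linarith, by linarith, ⟨-b, a, by linear_combination hdet⟩⟩,
    hdet, by linarith⟩

/-- Consecutive Farey fractions have determinant one. -/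
theorem IsFareyPred.det_eq_one {h : ℕ} {a b a' b' : ℤ} (hF : IsFareyPred h a b a' b') :
    a * b' - a' * b = 1 := by
  obtain ⟨hab, ⟨hb', hbh', hcop⟩, hlt, hgap⟩ := hF
  obtain ⟨p, q, hpq, hdet, hlarge⟩ := exists_left_neighbour hab
  have hb : 0 < b := hab.1
  have hq : 0 < q := hpq.1
  have hd : 0 < a * b' - a' * b := by
    rw [div_lt_div_iff₀ (by exact_mod_cast hb') (by exact_mod_cast hb)] at hlt
    norm_cast at hlt
    linarith
  have he : 0 ≤ a' * q - p * b' := by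
    rcases hgap p q hpq with hle | hle
    · rw [div_le_div_iff₀ (by exact_mod_cast hq) (by exact_mod_cast hb')] at hle
      norm_cast at hle
      linarith
    · rw [div_le_div_iff₀ (by exact_mod_cast hb) (by exact_mod_cast hq)] at hle
      norm_cast at hle
      linarith
  have hb'_eq : b' = b * (a' * q - p * b') + q * (a * b' - a' * b) := by
    linear_combination (-b') * hdet
  have ha'_eq : a' = a * (a' * q - p * b') + p * (a * b' - a' * b) := by
    linear_combination (-a') * hdet
  have he0 : a' * q - p * b' = 0 := by
    by_contra hne
    have he1 : 1 ≤ a' * q - p * b' := by omega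
    nlinarith [mul_le_mul_of_nonneg_left he1 hb.le, mul_le_mul_of_nonneg_left hd hq.le]
  rw [he0, mul_zero, zero_add] at hb'_eq ha'_eq
  have hunit : IsUnit (a * b' - a' * b) :=
    hcop.isUnit_of_dvd' (Dvd.intro_left _ ha'_eq.symm) (Dvd.intro_left _ hb'_eq.symm)
  rcases Int.isUnit_iff.mp hunit with h1 | h1 <;> omega

/-- A point at distance `s ≥ 0` to the left of `a/b` lies in the `h`-Farey interval ending at `a/b`
if and only if `s < 1/(bb')`. -/
theorem IsFareyPred.isFareyIntervalOf_sub_iff {h : ℕ} {a b a' b' : ℤ}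
    (hF : IsFareyPred h a b a' b') {s : ℚ} (hs : 0 ≤ s) :
    IsFareyIntervalOf h ((a : ℚ) / b - s) a b a' b' ↔ s < 1 / ((b : ℚ) * b') := by
  have hb : (b : ℚ) ≠ 0 := by exact_mod_cast hF.1.1.ne'
  have hb' : (b' : ℚ) ≠ 0 := by exact_mod_cast hF.2.1.1.ne'
  have hdet : (a : ℚ) * b' - a' * b = 1 := by exact_mod_cast hF.det_eq_one
  have hgap : (a : ℚ) / b - (a' : ℚ) / b' = 1 / ((b : ℚ) * b') := by
    rw [div_sub_div _ _ hb hb', ← hdet, mul_comm (a' : ℚ)]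
  rw [← hgap]
  constructor
  · rintro ⟨-, hx, -⟩
    linarith
  · intro hx
    exact ⟨hF, by linarith, by linarith⟩

theorem tParam_construction (h : ℕ) (a b : ℤ) (Δ : Finset ℕ) (τ m : ℤ) :
    tParam h a b (construction h a b Δ τ m) =
      (τ : ℚ) + Int.fract ((a : ℚ) * (h : ℚ) * (m : ℚ) / (b : ℚ)) := by
  simp only [tParam, construction, conductor, Int.fract]
  push_cast
  ring

theorem leftGens_eq (h : ℕ) (a b : ℤ) (Δ : Finset ℕ) (τ m : ℤ) :
    leftGens h a b Δ τ m =
      Δ.image fun δ : ℕ => (conductor h a b τ m + m - 1) / (h : ℤ) - (δ : ℤ) := by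
  simp only [leftGens, Rat.floor_intCast_div_natCast]

theorem min'_leftGens (h : ℕ) (a b : ℤ) (Δ : Finset ℕ) (hΔ : Δ.Nonempty) (τ m : ℤ)
    (hΓ : (leftGens h a b Δ τ m).Nonempty) :
    (leftGens h a b Δ τ m).min' hΓ =
      (conductor h a b τ m + m - 1) / (h : ℤ) - (Δ.max' hΔ : ℤ) := by
  refine (Finset.min'_eq_iff _ hΓ _).mpr ⟨?_, fun x hx => ?_⟩
  · rw [leftGens_eq]
    exact Finset.mem_image_of_mem _ (Δ.max'_mem hΔ)
  · rw [leftGens_eq] at hx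
    obtain ⟨δ, hδ, rfl⟩ := Finset.mem_image.mp hx
    have : δ ≤ Δ.max' hΔ := Δ.le_max' δ hδ
    omega

theorem wParam_construction (h : ℕ) (a b : ℤ) (Δ : Finset ℕ) (hΔ : Δ.Nonempty) (τ m : ℤ)
    (hΓ : (construction h a b Δ τ m).Γ.Nonempty) :
    wParam h (construction h a b Δ τ m) hΓ =
      (h : ℤ) * (Δ.max' hΔ : ℤ) + 1 + ((construction h a b Δ τ m).c + m - 1) % (h : ℤ) := by
  have hmin := min'_leftGens h a b Δ hΔ τ m hΓ
  simp only [wParam, construction] at hmin ⊢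
  rw [hmin]
  linear_combination -(Int.mul_ediv_add_emod (conductor h a b τ m + m - 1) h)

/-- If `hγ < c + m` for all `γ ∈ Γ`, then `h`-regularity amounts to `w ≤ m`. -/
theorem Presentation.isRegular_iff_wParam_le {h : ℕ} (S : Presentation)
    (hΓ : S.Γ.Nonempty) (hlt : ∀ γ ∈ S.Γ, (h : ℤ) * γ < S.c + S.m) :
    S.IsRegular h ↔ wParam h S hΓ ≤ S.m := by
  rw [wParam]
  constructor
  · intro hreg
    have hmem : (h : ℤ) * S.Γ.min' hΓ ∈ sumset h S.Γ :=
      ⟨fun _ => S.Γ.min' hΓ, fun _ => S.Γ.min'_mem hΓ, by simp⟩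
    have := (hreg hmem).1
    linarith
  · rintro hw _ ⟨g, hg, rfl⟩
    have hlow : (h : ℤ) * S.Γ.min' hΓ ≤ ∑ i, g i := by
      simpa using Finset.card_nsmul_le_sum Finset.univ g _ fun i _ => S.Γ.min'_le _ (hg i)
    have hup : ∑ i, g i ≤ (h : ℤ) * S.Γ.max' hΓ := by
      simpa using Finset.sum_le_card_nsmul Finset.univ g _ fun i _ => S.Γ.le_max' _ (hg i)
    exact ⟨by linarith, hup.trans_lt (hlt _ (S.Γ.max'_mem hΓ))⟩

theorem mul_lt_of_mem_leftGens {h : ℕ} (hh : 0 < h) {a b : ℤ} {Δ : Finset ℕ} {τ m γ : ℤ}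
    (hγ : γ ∈ leftGens h a b Δ τ m) : (h : ℤ) * γ < conductor h a b τ m + m := by
  rw [leftGens_eq] at hγ
  obtain ⟨δ, -, rfl⟩ := Finset.mem_image.mp hγ
  have hle := Int.mul_ediv_self_le (x := conductor h a b τ m + m - 1) (k := h) (by omega)
  have : (0 : ℤ) ≤ h * δ := by positivity
  rw [mul_sub]
  linarith

theorem IsFareyPred.isFareyIntervalOf_iff_tParam {h : ℕ} (hh : 0 < h) {a b a' b' : ℤ}
    (hF : IsFareyPred h a b a' b') (S : Presentation) (hm : 0 < S.m)
    (ht : 0 ≤ tParam h a b S) :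
    IsFareyIntervalOf h (((S.c + S.m : ℤ) : ℚ) / ((h : ℚ) * (S.m : ℚ))) a b a' b' ↔
      (b : ℚ) * (b' : ℚ) * tParam h a b S / (h : ℚ) < (S.m : ℚ) := by
  have hbQ : (0 : ℚ) < b := by exact_mod_cast hF.1.1
  have hbQ' : (0 : ℚ) < b' := by exact_mod_cast hF.2.1.1
  have hhQ : (0 : ℚ) < h := by exact_mod_cast hh
  have hmQ : (0 : ℚ) < S.m := by exact_mod_cast hm
  have hx : ((S.c + S.m : ℤ) : ℚ) / ((h : ℚ) * (S.m : ℚ)) =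
      (a : ℚ) / b - tParam h a b S / ((h : ℚ) * S.m) := by
    rw [tParam]
    push_cast
    field_simp
    ring
  rw [hx, hF.isFareyIntervalOf_sub_iff (by positivity),
    div_lt_div_iff₀ (by positivity) (by positivity), div_lt_iff₀ hhQ]
  constructor <;> intro hlt <;> linarith

end Eliahou

theorem construction_t_w_regular_farey (h : ℕ) (hh : 2 ≤ h) (a b a' b' : ℤ)
    (hF : Eliahou.IsFareyPred h a b a' b') (Δ : Finset ℕ) (hΔ : Δ.Nonempty) (τ m : ℤ) :
    let S := Eliahou.construction h a b Δ τ m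
    let hΓ : S.Γ.Nonempty := Eliahou.construction_Γ_nonempty h a b Δ hΔ τ m
    Eliahou.tParam h a b S = (τ : ℚ) + Int.fract ((a : ℚ) * (h : ℚ) * (m : ℚ) / (b : ℚ)) ∧
    Eliahou.wParam h S hΓ = (h : ℤ) * (Δ.max' hΔ : ℤ) + 1 + (S.c + m - 1) % (h : ℤ) ∧
    (S.IsRegular h ↔ Eliahou.wParam h S hΓ ≤ m) ∧
    (0 < m → 0 ≤ τ →
      (Eliahou.IsFareyIntervalOf h (((S.c + m : ℤ) : ℚ) / ((h : ℚ) * (m : ℚ))) a b a' b' ↔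
        (b : ℚ) * (b' : ℚ) * Eliahou.tParam h a b S / (h : ℚ) < (m : ℚ))) := by
  have hpos : 0 < h := by omega
  intro S hΓ
  have ht := Eliahou.tParam_construction h a b Δ τ m
  refine ⟨ht, Eliahou.wParam_construction h a b Δ hΔ τ m hΓ,
    S.isRegular_iff_wParam_le hΓ fun γ hγ => Eliahou.mul_lt_of_mem_leftGens hpos hγ,
    fun hm hτ => hF.isFareyIntervalOf_iff_tParam hpos S hm ?_⟩
  rw [ht]
  exact add_nonneg (by exact_mod_cast hτ) (Int.fract_nonneg _)
end
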